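/- arXiv:math/0009236 — 2 statements merged into one kernel-verified Lean document; each statement's English description precedes it below -/
import Mathlib

section
/- Let H be a Hopf algebra and A an H-module algebra. Then A ⊗ H with componentwise multiplication (a⊗h)(b⊗g) = ab ⊗ hg, the H-action g·(a⊗h) = g⁽¹⁾·a ⊗ g⁽⁰⁾ h S(g⁽²⁾), and the coaction ρ(a⊗h) = (a ⊗ h⁽¹⁾) ⊗ S⁻¹(h⁽⁰⁾) is a Yetter-Drinfeld H-module algebra. -/
universe u

open Finset in
/-- A Hopf algebra over `k` presented in pointwise (Sweedler) form: for every
`h : H`, the comultiplication is `Δ h = ∑ i < len h, Δ₁ h i ⊗ Δ₂ h i`.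
Coalgebra identities that live in tensor powers of `H` are expressed in the
equivalent "separating" form, i.e. after applying an arbitrary multilinear map
with values in an arbitrary `k`-module. -/
structure SweedlerHopf (k : Type u) (H : Type u) [Field k] [Ring H] [Algebra k H] where
  len : H → ℕ
  Δ₁ : H → ℕ → H
  Δ₂ : H → ℕ → H
  ε : H →ₐ[k] k
  S : H →ₗ[k] H
  Sinv : H →ₗ[k] H
  S_Sinv : ∀ h, S (Sinv h) = h
  Sinv_S : ∀ h, Sinv (S h) = h
  counit_left : ∀ h : H, (∑ i ∈ range (len h), ε (Δ₁ h i) • Δ₂ h i) = h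
  counit_right : ∀ h : H, (∑ i ∈ range (len h), ε (Δ₂ h i) • Δ₁ h i) = h
  coassoc : ∀ (M : Type u) [AddCommGroup M] [Module k M]
      (φ : H →ₗ[k] H →ₗ[k] H →ₗ[k] M) (h : H),
      (∑ i ∈ range (len h), ∑ j ∈ range (len (Δ₁ h i)),
        φ (Δ₁ (Δ₁ h i) j) (Δ₂ (Δ₁ h i) j) (Δ₂ h i))
      = ∑ i ∈ range (len h), ∑ j ∈ range (len (Δ₂ h i)),
        φ (Δ₁ h i) (Δ₁ (Δ₂ h i) j) (Δ₂ (Δ₂ h i) j)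
  comul_mul : ∀ (M : Type u) [AddCommGroup M] [Module k M]
      (φ : H →ₗ[k] H →ₗ[k] M) (g h : H),
      (∑ i ∈ range (len (g * h)), φ (Δ₁ (g * h) i) (Δ₂ (g * h) i))
      = ∑ i ∈ range (len g), ∑ j ∈ range (len h),
          φ (Δ₁ g i * Δ₁ h j) (Δ₂ g i * Δ₂ h j)
  comul_one : ∀ (M : Type u) [AddCommGroup M] [Module k M]
      (φ : H →ₗ[k] H →ₗ[k] M),
      (∑ i ∈ range (len 1), φ (Δ₁ 1 i) (Δ₂ 1 i)) = φ 1 1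
  antipode_left : ∀ h : H, (∑ i ∈ range (len h), S (Δ₁ h i) * Δ₂ h i) = ε h • 1
  antipode_right : ∀ h : H, (∑ i ∈ range (len h), Δ₁ h i * S (Δ₂ h i)) = ε h • 1
  S_mul : ∀ g h : H, S (g * h) = S h * S g
  S_one : S 1 = 1
  comul_S : ∀ (M : Type u) [AddCommGroup M] [Module k M]
      (φ : H →ₗ[k] H →ₗ[k] M) (g : H),
      (∑ i ∈ range (len (S g)), φ (Δ₁ (S g) i) (Δ₂ (S g) i))
      = ∑ i ∈ range (len g), φ (S (Δ₂ g i)) (S (Δ₁ g i))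
  comul_Sinv : ∀ (M : Type u) [AddCommGroup M] [Module k M]
      (φ : H →ₗ[k] H →ₗ[k] M) (g : H),
      (∑ i ∈ range (len (Sinv g)), φ (Δ₁ (Sinv g) i) (Δ₂ (Sinv g) i))
      = ∑ i ∈ range (len g), φ (Sinv (Δ₂ g i)) (Sinv (Δ₁ g i))

open Finset in
/-- A left `H`-module algebra (`H`-algebra) over the Sweedler-presented Hopf
algebra `𝓗`: `h ⬝ (a b) = ∑ (h⁽⁰⁾ ⬝ a)(h⁽¹⁾ ⬝ b)` and `h ⬝ 1 = ε(h) 1`. -/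
structure SweedlerMA {k H : Type u} [Field k] [Ring H] [Algebra k H]
    (𝓗 : SweedlerHopf k H) (A : Type u) [Ring A] [Algebra k A] where
  act : H →ₗ[k] A →ₗ[k] A
  act_mul : ∀ (g h : H) (a : A), act (g * h) a = act g (act h a)
  act_one : ∀ a : A, act 1 a = a
  act_mul_distrib : ∀ (h : H) (a b : A),
      act h (a * b) = ∑ i ∈ range (𝓗.len h), act (𝓗.Δ₁ h i) a * act (𝓗.Δ₂ h i) b
  act_unit : ∀ h : H, act h 1 = 𝓗.ε h • 1

open Finset in
/-- A Yetter-Drinfeld `H`-algebra: a left `H`-module algebra which is a right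
`H^{op}`-comodule algebra (coaction presented pointwise as
`ρ a = ∑ j < ρlen a, ρA a j ⊗ ρH a j`) satisfying the Yetter-Drinfeld
compatibility condition. -/
structure SweedlerYD {k H : Type u} [Field k] [Ring H] [Algebra k H]
    (𝓗 : SweedlerHopf k H) (A : Type u) [Ring A] [Algebra k A]
    extends SweedlerMA 𝓗 A where
  ρlen : A → ℕ
  ρA : A → ℕ → A
  ρH : A → ℕ → H
  ρ_counit : ∀ a : A, (∑ j ∈ range (ρlen a), 𝓗.ε (ρH a j) • ρA a j) = a
  ρ_coassoc : ∀ (M : Type u) [AddCommGroup M] [Module k M]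
      (φ : A →ₗ[k] H →ₗ[k] H →ₗ[k] M) (a : A),
      (∑ j ∈ range (ρlen a), ∑ l ∈ range (ρlen (ρA a j)),
        φ (ρA (ρA a j) l) (ρH (ρA a j) l) (ρH a j))
      = ∑ j ∈ range (ρlen a), ∑ l ∈ range (𝓗.len (ρH a j)),
          φ (ρA a j) (𝓗.Δ₁ (ρH a j) l) (𝓗.Δ₂ (ρH a j) l)
  ρ_mul : ∀ (M : Type u) [AddCommGroup M] [Module k M]
      (φ : A →ₗ[k] H →ₗ[k] M) (a b : A),
      (∑ j ∈ range (ρlen (a * b)), φ (ρA (a * b) j) (ρH (a * b) j))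
      = ∑ j ∈ range (ρlen a), ∑ l ∈ range (ρlen b),
          φ (ρA a j * ρA b l) (ρH b l * ρH a j)
  ρ_one : ∀ (M : Type u) [AddCommGroup M] [Module k M]
      (φ : A →ₗ[k] H →ₗ[k] M),
      (∑ j ∈ range (ρlen (1 : A)), φ (ρA 1 j) (ρH 1 j)) = φ 1 1
  yd : ∀ (M : Type u) [AddCommGroup M] [Module k M]
      (φ : A →ₗ[k] H →ₗ[k] M) (h : H) (a : A),
      (∑ i ∈ range (𝓗.len h), ∑ j ∈ range (ρlen (act (𝓗.Δ₂ h i) a)),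
        φ (ρA (act (𝓗.Δ₂ h i) a) j) (ρH (act (𝓗.Δ₂ h i) a) j * 𝓗.Δ₁ h i))
      = ∑ i ∈ range (𝓗.len h), ∑ j ∈ range (ρlen a),
          φ (act (𝓗.Δ₁ h i) (ρA a j)) (𝓗.Δ₂ h i * ρH a j)
open scoped TensorProduct

namespace SwYD
set_option linter.unusedSectionVars false

/-- Linearity as a class, so that instance search proves it. -/
class Lin (k : Type u) [Field k] {V W : Type u} [AddCommGroup V] [Module k V]
    [AddCommGroup W] [Module k W] (f : V → W) : Prop where
  add : ∀ x y, f (x + y) = f x + f y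
  smul : ∀ (c : k) x, f (c • x) = c • f x

section basic
variable {k : Type u} [Field k] {V W X Y Z M : Type u}
  [AddCommGroup V] [Module k V] [AddCommGroup W] [Module k W]
  [AddCommGroup X] [Module k X] [AddCommGroup Y] [Module k Y]
  [AddCommGroup Z] [Module k Z] [AddCommGroup M] [Module k M]

/-- bundled version -/
def Lin.toL (k : Type u) [Field k] {V W : Type u} [AddCommGroup V] [Module k V]
    [AddCommGroup W] [Module k W] (f : V → W) [Lin k f] : V →ₗ[k] W where
  toFun := f
  map_add' := Lin.add (k := k)
  map_smul' := Lin.smul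

/-- bundled bilinear -/
def bi (k : Type u) [Field k] {V W X : Type u} [AddCommGroup V] [Module k V]
    [AddCommGroup W] [Module k W] [AddCommGroup X] [Module k X] (F : V → W → X)
    [∀ b, Lin k (fun a => F a b)] [∀ a, Lin k (fun b => F a b)] : V →ₗ[k] W →ₗ[k] X :=
  LinearMap.mk₂ k F (fun a b c => Lin.add (k := k) (f := fun a => F a c) a b)
    (fun c a b => Lin.smul (f := fun a => F a b) c a)
    (fun a b c => Lin.add (k := k) (f := fun b => F a b) b c)
    (fun c a b => Lin.smul (f := fun b => F a b) c b)

@[simp] theorem bi_apply (F : V → W → X)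
    [∀ b, Lin k (fun a => F a b)] [∀ a, Lin k (fun b => F a b)] (a : V) (b : W) :
    bi k F a b = F a b := rfl

/-- bundled trilinear -/
def tri (k : Type u) [Field k] {V W X Y : Type u} [AddCommGroup V] [Module k V]
    [AddCommGroup W] [Module k W] [AddCommGroup X] [Module k X]
    [AddCommGroup Y] [Module k Y] (F : V → W → X → Y)
    [∀ b c, Lin k (fun a => F a b c)] [∀ a c, Lin k (fun b => F a b c)]
    [∀ a b, Lin k (fun c => F a b c)] : V →ₗ[k] W →ₗ[k] X →ₗ[k] Y :=
  LinearMap.mk₂ k (fun a b => Lin.toL k (fun c => F a b c))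
    (fun a b c => LinearMap.ext fun d => Lin.add (k := k) (f := fun a => F a c d) a b)
    (fun c a b => LinearMap.ext fun d => Lin.smul (f := fun a => F a b d) c a)
    (fun a b c => LinearMap.ext fun d => Lin.add (k := k) (f := fun b => F a b d) b c)
    (fun c a b => LinearMap.ext fun d => Lin.smul (f := fun b => F a b d) c b)

instance lin_id : Lin k (fun x : V => x) := ⟨fun _ _ => rfl, fun _ _ => rfl⟩
instance lin_app (φ : W →ₗ[k] X) (f : V → W) [Lin k f] : Lin k (fun x => φ (f x)) :=
  ⟨fun x y => by rw [Lin.add (k := k) (f := f)]; simp,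
   fun c y => by rw [Lin.smul (f := f)]; simp⟩
instance lin_app2 (φ : W →ₗ[k] X →ₗ[k] Y) (f : V → W) [Lin k f] (c : X) :
    Lin k (fun x => φ (f x) c) :=
  ⟨fun x y => by rw [Lin.add (k := k) (f := f)]; simp,
   fun c y => by rw [Lin.smul (f := f)]; simp⟩
instance lin_app3 (φ : W →ₗ[k] X →ₗ[k] Y →ₗ[k] Z) (f : V → W) [Lin k f] (c : X) (d : Y) :
    Lin k (fun x => φ (f x) c d) :=
  ⟨fun x y => by rw [Lin.add (k := k) (f := f)]; simp,
   fun c y => by rw [Lin.smul (f := f)]; simp⟩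
instance lin_tl (f : V → W) [Lin k f] (c : X) : Lin k (fun x => f x ⊗ₜ[k] c) :=
  ⟨fun x y => by rw [Lin.add (k := k) (f := f), TensorProduct.add_tmul],
   fun c y => by rw [Lin.smul (f := f), TensorProduct.smul_tmul']⟩
instance lin_tr (f : V → W) [Lin k f] (c : X) : Lin k (fun x => c ⊗ₜ[k] f x) :=
  ⟨fun x y => by rw [Lin.add (k := k) (f := f), TensorProduct.tmul_add],
   fun c y => by rw [Lin.smul (f := f), TensorProduct.tmul_smul]⟩
instance lin_ml {R : Type u} [Ring R] [Algebra k R] (f : V → R) [Lin k f] (c : R) :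
    Lin k (fun x => f x * c) :=
  ⟨fun x y => by rw [Lin.add (k := k) (f := f), add_mul],
   fun c y => by rw [Lin.smul (f := f), smul_mul_assoc]⟩
instance lin_mr {R : Type u} [Ring R] [Algebra k R] (f : V → R) [Lin k f] (c : R) :
    Lin k (fun x => c * f x) :=
  ⟨fun x y => by rw [Lin.add (k := k) (f := f), mul_add],
   fun c y => by rw [Lin.smul (f := f), mul_smul_comm]⟩
instance lin_sl (f : V → k) [Lin k f] (c : W) : Lin k (fun x => f x • c) :=
  ⟨fun x y => by rw [Lin.add (k := k) (f := f), add_smul],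
   fun c y => by rw [Lin.smul (f := f), smul_assoc]⟩
instance lin_sr (f : V → W) [Lin k f] (c : k) : Lin k (fun x => c • f x) :=
  ⟨fun x y => by rw [Lin.add (k := k) (f := f), smul_add],
   fun d y => by rw [Lin.smul (f := f), smul_comm]⟩
instance lin_alg {R : Type u} [Ring R] [Algebra k R] (φ : R →ₐ[k] k) (f : V → R) [Lin k f] :
    Lin k (fun x => φ (f x)) :=
  ⟨fun x y => by rw [Lin.add (k := k) (f := f)]; simp,
   fun d y => by rw [Lin.smul (f := f)]; simp⟩

instance lin_coe (φ : V →ₗ[k] W) : Lin k (φ : V → W) := ⟨map_add φ, map_smul φ⟩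
instance lin_algcoe {R : Type u} [Ring R] [Algebra k R] (φ : R →ₐ[k] k) :
    Lin k (φ : R → k) := ⟨map_add φ, map_smul φ⟩
instance lin_mr_eta {R : Type u} [Ring R] [Algebra k R] (c : R) :
    Lin k (HMul.hMul c : R → R) := lin_mr (fun x => x) c
instance lin_tr_eta (c : X) : Lin k (TensorProduct.tmul k c : V → X ⊗[k] V) :=
  lin_tr (fun x => x) c
instance lin_sr_eta (c : k) : Lin k (HSMul.hSMul c : V → V) := lin_sr (fun x => x) c

theorem lin_sum {ι : Type*} (f : V → W) [Lin k f] (s : Finset ι) (g : ι → V) :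
    f (∑ i ∈ s, g i) = ∑ i ∈ s, f (g i) :=
  map_sum (Lin.toL k f) g s

theorem lin_ext (f g : V ⊗[k] W → X) [Lin k f] [Lin k g]
    (h : ∀ a b, f (a ⊗ₜ[k] b) = g (a ⊗ₜ[k] b)) (x) : f x = g x := by
  have : Lin.toL k f = Lin.toL k g := TensorProduct.ext' h
  exact congrArg (fun t : V ⊗[k] W →ₗ[k] X => t x) this

/-- Sweedler sum -/
def rs {X Y Z M : Type u} [AddCommGroup M] (len : X → ℕ) (P : X → ℕ → Y) (Q : X → ℕ → Z)
    (F : Y → Z → M) (x : X) : M := ∑ j ∈ Finset.range (len x), F (P x j) (Q x j)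

/-- the (co)multiplication is linear -/
class LinR (k : Type u) [Field k] {X Y Z : Type u} [AddCommGroup X] [Module k X]
    [AddCommGroup Y] [Module k Y] [AddCommGroup Z] [Module k Z]
    (len : X → ℕ) (P : X → ℕ → Y) (Q : X → ℕ → Z) : Prop where
  lin : ∀ (M : Type u) [AddCommGroup M] [Module k M] (φ : Y →ₗ[k] Z →ₗ[k] M),
    Lin k (rs len P Q (fun a b => φ a b))

variable (len : X → ℕ) (P : X → ℕ → Y) (Q : X → ℕ → Z)

instance lin_rs [LinR k len P Q] (F : Y → Z → M) (f : V → X) [Lin k f]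
    [∀ b, Lin k (fun a => F a b)] [∀ a, Lin k (fun b => F a b)] :
    Lin k (fun x => rs len P Q F (f x)) := by
  have h : Lin k (rs len P Q F) := LinR.lin M (bi k F)
  exact ⟨fun x y => by rw [Lin.add (k := k) (f := f), Lin.add (k := k) (f := rs len P Q F)],
    fun d y => by rw [Lin.smul (f := f), Lin.smul (f := rs len P Q F)]⟩

instance lin_rs_eta [LinR k len P Q] (F : Y → Z → M)
    [∀ b, Lin k (fun a => F a b)] [∀ a, Lin k (fun b => F a b)] :
    Lin k (rs len P Q F) := LinR.lin M (bi k F)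

instance lin_rs' (F : V → Y → Z → M) [∀ a b, Lin k (fun x => F x a b)] (z : X) :
    Lin k (fun x => rs len P Q (fun a b => F x a b) z) := by
  refine ⟨fun x y => ?_, fun c y => ?_⟩
  · simp only [rs, ← Finset.sum_add_distrib]
    exact Finset.sum_congr rfl fun i _ => Lin.add (k := k) (f := fun x => F x _ _) x y
  · simp only [rs, Finset.smul_sum]
    exact Finset.sum_congr rfl fun i _ => Lin.smul (f := fun x => F x _ _) c y

theorem rs_push (f : M → W) [Lin k f] (F : Y → Z → M) (x : X) :
    f (rs len P Q F x) = rs len P Q (fun a b => f (F a b)) x :=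
  lin_sum (k := k) f _ _

end basic

theorem rs_congr {X Y Z M : Type u} [AddCommGroup M] {len : X → ℕ} {P : X → ℕ → Y}
    {Q : X → ℕ → Z} {F G : Y → Z → M} {x : X} (h : ∀ a b, F a b = G a b) :
    rs len P Q F x = rs len P Q G x := by
  have : F = G := by funext a b; exact h a b
  rw [this]

theorem rs_comm {X Y Z X' Y' Z' M : Type u} [AddCommGroup M] {len : X → ℕ} {P : X → ℕ → Y}
    {Q : X → ℕ → Z} {len' : X' → ℕ} {P' : X' → ℕ → Y'}
    {Q' : X' → ℕ → Z'} (F : Y → Z → Y' → Z' → M) (x : X) (y : X') :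
    rs len P Q (fun a b => rs len' P' Q' (fun c d => F a b c d) y) x
    = rs len' P' Q' (fun c d => rs len P Q (fun a b => F a b c d) x) y :=
  Finset.sum_comm

section hopf
variable {k H : Type u} [Field k] [Ring H] [Algebra k H] (𝓗 : SweedlerHopf k H)
  {M : Type u} [AddCommGroup M] [Module k M]

theorem sw_coassoc (F : H → H → H → M)
    [∀ b c, Lin k (fun a => F a b c)] [∀ a c, Lin k (fun b => F a b c)]
    [∀ a b, Lin k (fun c => F a b c)] (h : H) :
    rs 𝓗.len 𝓗.Δ₁ 𝓗.Δ₂ (fun x c => rs 𝓗.len 𝓗.Δ₁ 𝓗.Δ₂ (fun a b => F a b c) x) h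
    = rs 𝓗.len 𝓗.Δ₁ 𝓗.Δ₂ (fun a x => rs 𝓗.len 𝓗.Δ₁ 𝓗.Δ₂ (fun b c => F a b c) x) h :=
  𝓗.coassoc M (tri k F) h

theorem sw_mul (F : H → H → M) [∀ b, Lin k (fun a => F a b)] [∀ a, Lin k (fun b => F a b)]
    (g h : H) :
    rs 𝓗.len 𝓗.Δ₁ 𝓗.Δ₂ F (g * h) = rs 𝓗.len 𝓗.Δ₁ 𝓗.Δ₂ (fun a b => rs 𝓗.len 𝓗.Δ₁ 𝓗.Δ₂ (fun c d => F (a * c) (b * d)) h) g :=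
  𝓗.comul_mul M (bi k F) g h

theorem sw_one (F : H → H → M) [∀ b, Lin k (fun a => F a b)] [∀ a, Lin k (fun b => F a b)] :
    rs 𝓗.len 𝓗.Δ₁ 𝓗.Δ₂ F 1 = F 1 1 := 𝓗.comul_one M (bi k F)

theorem sw_S (F : H → H → M) [∀ b, Lin k (fun a => F a b)] [∀ a, Lin k (fun b => F a b)]
    (g : H) : rs 𝓗.len 𝓗.Δ₁ 𝓗.Δ₂ F (𝓗.S g) = rs 𝓗.len 𝓗.Δ₁ 𝓗.Δ₂ (fun a b => F (𝓗.S b) (𝓗.S a)) g :=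
  𝓗.comul_S M (bi k F) g

theorem sw_Sinv (F : H → H → M) [∀ b, Lin k (fun a => F a b)] [∀ a, Lin k (fun b => F a b)]
    (g : H) : rs 𝓗.len 𝓗.Δ₁ 𝓗.Δ₂ F (𝓗.Sinv g) = rs 𝓗.len 𝓗.Δ₁ 𝓗.Δ₂ (fun a b => F (𝓗.Sinv b) (𝓗.Sinv a)) g :=
  𝓗.comul_Sinv M (bi k F) g

theorem sw_counit_left (f : H → M) [Lin k f] (h : H) :
    rs 𝓗.len 𝓗.Δ₁ 𝓗.Δ₂ (fun a b => 𝓗.ε a • f b) h = f h := by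
  conv_rhs => rw [← 𝓗.counit_left h, lin_sum (k := k) f]
  exact Finset.sum_congr rfl fun i _ => (Lin.smul _ _).symm

theorem sw_counit_right (f : H → M) [Lin k f] (h : H) :
    rs 𝓗.len 𝓗.Δ₁ 𝓗.Δ₂ (fun a b => 𝓗.ε b • f a) h = f h := by
  conv_rhs => rw [← 𝓗.counit_right h, lin_sum (k := k) f]
  exact Finset.sum_congr rfl fun i _ => (Lin.smul _ _).symm

theorem sw_anti_left (f : H → M) [Lin k f] (h : H) :
    rs 𝓗.len 𝓗.Δ₁ 𝓗.Δ₂ (fun a b => f (𝓗.S a * b)) h = 𝓗.ε h • f 1 := by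
  rw [← Lin.smul (f := f), ← 𝓗.antipode_left h, lin_sum (k := k) f]; rfl

theorem sw_anti_right (f : H → M) [Lin k f] (h : H) :
    rs 𝓗.len 𝓗.Δ₁ 𝓗.Δ₂ (fun a b => f (a * 𝓗.S b)) h = 𝓗.ε h • f 1 := by
  rw [← Lin.smul (f := f), ← 𝓗.antipode_right h, lin_sum (k := k) f]; rfl

theorem toL_apply {V W : Type u} [AddCommGroup V] [Module k V]
    [AddCommGroup W] [Module k W] (f : V → W) [Lin k f] (x : V) : Lin.toL k f x = f x := rfl

theorem Sinv_mul (a b : H) : 𝓗.Sinv (a * b) = 𝓗.Sinv b * 𝓗.Sinv a := by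
  conv_lhs => rw [← 𝓗.S_Sinv a, ← 𝓗.S_Sinv b, ← 𝓗.S_mul, 𝓗.Sinv_S]

theorem Sinv_one : 𝓗.Sinv 1 = 1 := by
  conv_lhs => rw [← 𝓗.S_one, 𝓗.Sinv_S]

theorem sw_anti_inv (f : H → M) [Lin k f] (h : H) :
    rs 𝓗.len 𝓗.Δ₁ 𝓗.Δ₂ (fun a b => f (𝓗.Sinv b * a)) h = 𝓗.ε h • f 1 := by
  have := sw_anti_left 𝓗 (fun x => Lin.toL k f (𝓗.Sinv x)) h
  simpa only [toL_apply, Sinv_mul, 𝓗.Sinv_S, Sinv_one] using this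

theorem eps_S (h : H) : 𝓗.ε (𝓗.S h) = 𝓗.ε h := by
  have h1 := sw_anti_left 𝓗 (fun x => 𝓗.ε x) h
  have h2 := sw_counit_right 𝓗 (fun x => 𝓗.ε (𝓗.S x)) h
  rw [← h2]
  simp only [map_mul, map_one, smul_eq_mul, mul_one] at h1 ⊢
  rw [← h1]
  exact rs_congr fun a b => mul_comm _ _

theorem eps_Sinv (h : H) : 𝓗.ε (𝓗.Sinv h) = 𝓗.ε h := by
  rw [← eps_S, 𝓗.S_Sinv]

end hopf

section main
variable {k H A : Type u} [Field k] [Ring H] [Algebra k H] [Ring A] [Algebra k A]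
    (𝓗 : SweedlerHopf k H) (MA : SweedlerMA 𝓗 A)

/-- hypothesis on the action -/
def HAct (act2 : H →ₗ[k] (A ⊗[k] H) →ₗ[k] (A ⊗[k] H)) : Prop :=
  ∀ (g : H) (a : A) (h : H), act2 g (a ⊗ₜ[k] h) =
    rs 𝓗.len 𝓗.Δ₁ 𝓗.Δ₂ (fun x y => rs 𝓗.len 𝓗.Δ₁ 𝓗.Δ₂ (fun p q => MA.act q a ⊗ₜ[k] (p * h * 𝓗.S y)) x) g

variable [LinR k 𝓗.len 𝓗.Δ₁ 𝓗.Δ₂]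
variable {act2 : H →ₗ[k] (A ⊗[k] H) →ₗ[k] (A ⊗[k] H)} (hact : HAct 𝓗 MA act2)

theorem hact_right (hact : HAct 𝓗 MA act2) (g : H) (a : A) (h : H) :
    act2 g (a ⊗ₜ[k] h) =
    rs 𝓗.len 𝓗.Δ₁ 𝓗.Δ₂ (fun p x => rs 𝓗.len 𝓗.Δ₁ 𝓗.Δ₂ (fun q y => MA.act q a ⊗ₜ[k] (p * h * 𝓗.S y)) x) g := by
  rw [hact, sw_coassoc 𝓗 (fun p q y => MA.act q a ⊗ₜ[k] (p * h * 𝓗.S y))]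

theorem a_mul (hact : HAct 𝓗 MA act2) (g h : H) (x : A ⊗[k] H) :
    act2 (g * h) x = act2 g (act2 h x) := by
  refine lin_ext (k := k) (fun x => act2 (g * h) x) (fun x => act2 g (act2 h x)) (fun a b => ?_) x
  rw [hact, hact, sw_mul]
  simp only [sw_mul]
  rw [rs_push (k := k) _ _ _ (fun x => act2 g x), rs_comm]
  refine rs_congr fun c d => ?_
  rw [rs_push (k := k) _ _ _ (fun x => act2 g x)]
  simp only [hact _ _ _]
  conv_rhs => rw [rs_comm]
  refine rs_congr fun p q => ?_
  rw [rs_comm]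
  refine rs_congr fun u v => rs_congr fun u' v' => ?_
  simp only [MA.act_mul, 𝓗.S_mul, mul_assoc]

theorem a_one (hact : HAct 𝓗 MA act2) (x : A ⊗[k] H) : act2 1 x = x := by
  refine lin_ext (k := k) (fun x => act2 1 x) (fun x => x) (fun a b => ?_) x
  beta_reduce
  rw [hact, sw_one, sw_one]
  simp [MA.act_one, 𝓗.S_one]

theorem a_unit (hact : HAct 𝓗 MA act2) (h : H) : act2 h 1 = 𝓗.ε h • 1 := by
  rw [Algebra.TensorProduct.one_def, hact_right 𝓗 MA hact]
  simp only [MA.act_unit, mul_one]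
  rw [← sw_anti_right 𝓗 (fun x => (1 : A) ⊗ₜ[k] x)]
  refine rs_congr fun p x => ?_
  rw [← sw_counit_left 𝓗 (fun x => (1 : A) ⊗ₜ[k] (p * 𝓗.S x))]
  rfl


theorem a_distrib (hact : HAct 𝓗 MA act2) (g : H) (x y : A ⊗[k] H) :
    act2 g (x * y) = rs 𝓗.len 𝓗.Δ₁ 𝓗.Δ₂ (fun p q => act2 p x * act2 q y) g := by
  refine lin_ext (k := k) (fun x => act2 g (x * y))
    (fun x => rs 𝓗.len 𝓗.Δ₁ 𝓗.Δ₂ (fun p q => act2 p x * act2 q y) g) (fun a h => ?_) x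
  refine lin_ext (k := k) (fun y => act2 g ((a ⊗ₜ[k] h) * y))
    (fun y => rs 𝓗.len 𝓗.Δ₁ 𝓗.Δ₂ (fun p q => act2 p (a ⊗ₜ[k] h) * act2 q y) g) (fun b h' => ?_) y
  beta_reduce
  have lhs : act2 g ((a ⊗ₜ[k] h) * (b ⊗ₜ[k] h')) =
      rs 𝓗.len 𝓗.Δ₁ 𝓗.Δ₂ (fun p x => rs 𝓗.len 𝓗.Δ₁ 𝓗.Δ₂ (fun q w => rs 𝓗.len 𝓗.Δ₁ 𝓗.Δ₂ (fun q' y =>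
        (MA.act q a * MA.act q' b) ⊗ₜ[k] (p * (h * h') * 𝓗.S y)) w) x) g := by
    rw [Algebra.TensorProduct.tmul_mul_tmul, hact_right 𝓗 MA hact]
    refine rs_congr fun p x => ?_
    rw [← sw_coassoc 𝓗 (fun q q' y =>
        (MA.act q a * MA.act q' b) ⊗ₜ[k] (p * (h * h') * 𝓗.S y))]
    refine rs_congr fun q y => ?_
    rw [MA.act_mul_distrib]
    exact rs_push (k := k) _ _ _ (fun z : A => z ⊗ₜ[k] (p * (h * h') * 𝓗.S y))
      (fun q q' => MA.act q a * MA.act q' b) q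
  have key : ∀ p q z, rs 𝓗.len 𝓗.Δ₁ 𝓗.Δ₂ (fun t v => (MA.act q a ⊗ₜ[k] (p * h * 𝓗.S t)) * act2 v (b ⊗ₜ[k] h')) z
      = rs 𝓗.len 𝓗.Δ₁ 𝓗.Δ₂ (fun q' y => (MA.act q a * MA.act q' b) ⊗ₜ[k] (p * (h * h') * 𝓗.S y)) z := by
    intro p q z
    have e : ∀ t v, (MA.act q a ⊗ₜ[k] (p * h * 𝓗.S t)) * act2 v (b ⊗ₜ[k] h')
        = rs 𝓗.len 𝓗.Δ₁ 𝓗.Δ₂ (fun p' x' => rs 𝓗.len 𝓗.Δ₁ 𝓗.Δ₂ (fun q' y => (MA.act q a * MA.act q' b) ⊗ₜ[k]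
          (p * h * (𝓗.S t * p') * h' * 𝓗.S y)) x') v := by
      intro t v
      rw [hact_right 𝓗 MA hact, rs_push (k := k) _ _ _ (fun x => _ * x)]
      refine rs_congr fun p' x' => ?_
      rw [rs_push (k := k) _ _ _ (fun x => _ * x)]
      refine rs_congr fun q' y => ?_
      rw [Algebra.TensorProduct.tmul_mul_tmul]
      simp only [mul_assoc]
    simp only [e]
    rw [← sw_coassoc 𝓗 (fun t p' x' => rs 𝓗.len 𝓗.Δ₁ 𝓗.Δ₂ (fun q' y => (MA.act q a * MA.act q' b) ⊗ₜ[k]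
          (p * h * (𝓗.S t * p') * h' * 𝓗.S y)) x')]
    rw [← sw_counit_left 𝓗 (fun z => rs 𝓗.len 𝓗.Δ₁ 𝓗.Δ₂ (fun q' y => (MA.act q a * MA.act q' b) ⊗ₜ[k]
      (p * (h * h') * 𝓗.S y)) z)]
    refine rs_congr fun s x' => ?_
    rw [sw_anti_left 𝓗 (fun m => rs 𝓗.len 𝓗.Δ₁ 𝓗.Δ₂ (fun q' y => (MA.act q a * MA.act q' b) ⊗ₜ[k]
          (p * h * m * h' * 𝓗.S y)) x')]
    simp only [mul_one, mul_assoc]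
  rw [lhs]
  simp only [← key]
  have e2 : ∀ u v, act2 u (a ⊗ₜ[k] h) * act2 v (b ⊗ₜ[k] h') =
      rs 𝓗.len 𝓗.Δ₁ 𝓗.Δ₂ (fun p x => rs 𝓗.len 𝓗.Δ₁ 𝓗.Δ₂ (fun q t =>
        (MA.act q a ⊗ₜ[k] (p * h * 𝓗.S t)) * act2 v (b ⊗ₜ[k] h')) x) u := by
    intro u v
    rw [hact_right 𝓗 MA hact u, rs_push (k := k) _ _ _ (fun x => x * act2 v (b ⊗ₜ[k] h'))]
    refine rs_congr fun p' x' => ?_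
    rw [rs_push (k := k) _ _ _ (fun x => x * act2 v (b ⊗ₜ[k] h'))]
  simp only [e2]
  rw [sw_coassoc 𝓗 (fun p x v => rs 𝓗.len 𝓗.Δ₁ 𝓗.Δ₂ (fun q t =>
        (MA.act q a ⊗ₜ[k] (p * h * 𝓗.S t)) * act2 v (b ⊗ₜ[k] h')) x)]
  refine rs_congr fun p x => ?_
  rw [sw_coassoc 𝓗 (fun q t v => (MA.act q a ⊗ₜ[k] (p * h * 𝓗.S t)) * act2 v (b ⊗ₜ[k] h'))]

variable (ℓ : A ⊗[k] H → ℕ) (P : A ⊗[k] H → ℕ → A ⊗[k] H) (Q : A ⊗[k] H → ℕ → H)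

/-- hypothesis on the coaction -/
def HRho : Prop := ∀ (M : Type u) [AddCommGroup M] [Module k M]
      (φ : (A ⊗[k] H) →ₗ[k] H →ₗ[k] M) (a : A) (h : H),
      rs ℓ P Q (fun u v => φ u v) (a ⊗ₜ[k] h)
        = rs 𝓗.len 𝓗.Δ₁ 𝓗.Δ₂ (fun x y => φ (a ⊗ₜ[k] y) (𝓗.Sinv x)) h

variable [LinR k ℓ P Q] {M : Type u} [AddCommGroup M] [Module k M]

theorem rho_pure (hρ : HRho 𝓗 ℓ P Q) (F : A ⊗[k] H → H → M)
    [∀ b, Lin k (fun a => F a b)] [∀ a, Lin k (fun b => F a b)] (a : A) (h : H) :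
    rs ℓ P Q F (a ⊗ₜ[k] h) = rs 𝓗.len 𝓗.Δ₁ 𝓗.Δ₂ (fun x y => F (a ⊗ₜ[k] y) (𝓗.Sinv x)) h :=
  hρ M (bi k F) a h

theorem r_counit (hρ : HRho 𝓗 ℓ P Q) (x : A ⊗[k] H) :
    rs ℓ P Q (fun u v => 𝓗.ε v • u) x = x := by
  refine lin_ext (k := k) (fun x => rs ℓ P Q (fun u v => 𝓗.ε v • u) x) (fun x => x)
    (fun a h => ?_) x
  beta_reduce
  rw [rho_pure 𝓗 ℓ P Q hρ]
  simp only [eps_Sinv]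
  exact sw_counit_left 𝓗 (fun y => a ⊗ₜ[k] y) h

theorem r_coassoc (hρ : HRho 𝓗 ℓ P Q) (φ : (A ⊗[k] H) →ₗ[k] H →ₗ[k] H →ₗ[k] M)
    (x : A ⊗[k] H) :
    rs ℓ P Q (fun u v => rs ℓ P Q (fun u' v' => φ u' v' v) u) x
    = rs ℓ P Q (fun u v => rs 𝓗.len 𝓗.Δ₁ 𝓗.Δ₂ (fun c d => φ u c d) v) x := by
  refine lin_ext (k := k) (fun x => rs ℓ P Q (fun u v => rs ℓ P Q (fun u' v' => φ u' v' v) u) x)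
    (fun x => rs ℓ P Q (fun u v => rs 𝓗.len 𝓗.Δ₁ 𝓗.Δ₂ (fun c d => φ u c d) v) x)
    (fun a h => ?_) x
  beta_reduce
  rw [rho_pure 𝓗 ℓ P Q hρ, rho_pure 𝓗 ℓ P Q hρ]
  simp only [rho_pure 𝓗 ℓ P Q hρ, sw_Sinv]
  rw [sw_coassoc 𝓗 (fun c d y => φ (a ⊗ₜ[k] y) (𝓗.Sinv d) (𝓗.Sinv c))]

theorem r_mul (hρ : HRho 𝓗 ℓ P Q) (φ : (A ⊗[k] H) →ₗ[k] H →ₗ[k] M)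
    (x y : A ⊗[k] H) :
    rs ℓ P Q (fun u v => φ u v) (x * y)
    = rs ℓ P Q (fun u v => rs ℓ P Q (fun u' v' => φ (u * u') (v' * v)) y) x := by
  refine lin_ext (k := k) (fun x => rs ℓ P Q (fun u v => φ u v) (x * y))
    (fun x => rs ℓ P Q (fun u v => rs ℓ P Q (fun u' v' => φ (u * u') (v' * v)) y) x)
    (fun a h => ?_) x
  refine lin_ext (k := k) (fun y => rs ℓ P Q (fun u v => φ u v) ((a ⊗ₜ[k] h) * y))
    (fun y => rs ℓ P Q (fun u v => rs ℓ P Q (fun u' v' => φ (u * u') (v' * v)) y) (a ⊗ₜ[k] h))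
    (fun b h' => ?_) y
  beta_reduce
  rw [Algebra.TensorProduct.tmul_mul_tmul, rho_pure 𝓗 ℓ P Q hρ, rho_pure 𝓗 ℓ P Q hρ, sw_mul]
  simp only [rho_pure 𝓗 ℓ P Q hρ, Sinv_mul, Algebra.TensorProduct.tmul_mul_tmul]

theorem r_one (hρ : HRho 𝓗 ℓ P Q) (φ : (A ⊗[k] H) →ₗ[k] H →ₗ[k] M) :
    rs ℓ P Q (fun u v => φ u v) 1 = φ 1 1 := by
  rw [Algebra.TensorProduct.one_def, rho_pure 𝓗 ℓ P Q hρ, sw_one, Sinv_one]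

set_option synthInstance.maxHeartbeats 400000 in
set_option synthInstance.maxSize 10000 in
set_option maxHeartbeats 4000000 in
theorem r_yd (hact : HAct 𝓗 MA act2) (hρ : HRho 𝓗 ℓ P Q) (φ : (A ⊗[k] H) →ₗ[k] H →ₗ[k] M)
    (h : H) (x : A ⊗[k] H) :
    rs 𝓗.len 𝓗.Δ₁ 𝓗.Δ₂ (fun s y => rs ℓ P Q (fun u v => φ u (v * s)) (act2 y x)) h
    = rs 𝓗.len 𝓗.Δ₁ 𝓗.Δ₂ (fun s y => rs ℓ P Q (fun u v => φ (act2 s u) (y * v)) x) h := by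
  refine lin_ext (k := k)
    (fun x => rs 𝓗.len 𝓗.Δ₁ 𝓗.Δ₂ (fun s y => rs ℓ P Q (fun u v => φ u (v * s)) (act2 y x)) h)
    (fun x => rs 𝓗.len 𝓗.Δ₁ 𝓗.Δ₂ (fun s y => rs ℓ P Q (fun u v => φ (act2 s u) (y * v)) x) h)
    (fun a g => ?_) x
  beta_reduce
  -- right hand side
  have rhs : rs 𝓗.len 𝓗.Δ₁ 𝓗.Δ₂ (fun s y => rs ℓ P Q (fun u v => φ (act2 s u) (y * v)) (a ⊗ₜ[k] g)) h
      = rs 𝓗.len 𝓗.Δ₁ 𝓗.Δ₂ (fun p z => rs 𝓗.len 𝓗.Δ₁ 𝓗.Δ₂ (fun q r => rs 𝓗.len 𝓗.Δ₁ 𝓗.Δ₂ (fun r1 r2 => rs 𝓗.len 𝓗.Δ₁ 𝓗.Δ₂ (fun g1 g2 =>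
        φ (MA.act q a ⊗ₜ[k] (p * g2 * 𝓗.S r1)) (r2 * 𝓗.Sinv g1)) g) r) z) h := by
    have e : ∀ s y, rs ℓ P Q (fun u v => φ (act2 s u) (y * v)) (a ⊗ₜ[k] g)
        = rs 𝓗.len 𝓗.Δ₁ 𝓗.Δ₂ (fun p x => rs 𝓗.len 𝓗.Δ₁ 𝓗.Δ₂ (fun q r1 => rs 𝓗.len 𝓗.Δ₁ 𝓗.Δ₂ (fun g1 g2 =>
          φ (MA.act q a ⊗ₜ[k] (p * g2 * 𝓗.S r1)) (y * 𝓗.Sinv g1)) g) x) s := by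
      intro s y
      rw [rho_pure 𝓗 ℓ P Q hρ]
      have e' : ∀ g1 g2, φ (act2 s (a ⊗ₜ[k] g2)) (y * 𝓗.Sinv g1)
          = rs 𝓗.len 𝓗.Δ₁ 𝓗.Δ₂ (fun p x => rs 𝓗.len 𝓗.Δ₁ 𝓗.Δ₂ (fun q r1 =>
          φ (MA.act q a ⊗ₜ[k] (p * g2 * 𝓗.S r1)) (y * 𝓗.Sinv g1)) x) s := by
        intro g1 g2
        rw [hact_right 𝓗 MA hact, rs_push (k := k) _ _ _ (fun x => φ x (y * 𝓗.Sinv g1))]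
        refine rs_congr fun p x => ?_
        rw [rs_push (k := k) _ _ _ (fun x => φ x (y * 𝓗.Sinv g1))]
      simp only [e']
      rw [rs_comm]
      exact rs_congr fun p x => rs_comm _ _ _
    simp only [e]
    rw [sw_coassoc 𝓗 (fun p x y => rs 𝓗.len 𝓗.Δ₁ 𝓗.Δ₂ (fun q r1 => rs 𝓗.len 𝓗.Δ₁ 𝓗.Δ₂ (fun g1 g2 =>
          φ (MA.act q a ⊗ₜ[k] (p * g2 * 𝓗.S r1)) (y * 𝓗.Sinv g1)) g) x)]
    refine rs_congr fun p z => ?_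
    rw [sw_coassoc 𝓗 (fun q r1 y => rs 𝓗.len 𝓗.Δ₁ 𝓗.Δ₂ (fun g1 g2 =>
          φ (MA.act q a ⊗ₜ[k] (p * g2 * 𝓗.S r1)) (y * 𝓗.Sinv g1)) g)]
  rw [rhs]
  -- left hand side
  have lhs : ∀ s y, rs ℓ P Q (fun u v => φ u (v * s)) (act2 y (a ⊗ₜ[k] g))
      = rs 𝓗.len 𝓗.Δ₁ 𝓗.Δ₂ (fun p1 w => rs 𝓗.len 𝓗.Δ₁ 𝓗.Δ₂ (fun p z => rs 𝓗.len 𝓗.Δ₁ 𝓗.Δ₂ (fun q r => rs 𝓗.len 𝓗.Δ₁ 𝓗.Δ₂ (fun r1 r2 =>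
        rs 𝓗.len 𝓗.Δ₁ 𝓗.Δ₂ (fun g1 g2 => φ (MA.act q a ⊗ₜ[k] (p * g2 * 𝓗.S r1))
          (r2 * 𝓗.Sinv g1 * (𝓗.Sinv p1 * s))) g) r) z) w) y := by
    intro s y
    rw [← sw_coassoc 𝓗 (fun p1 p z => rs 𝓗.len 𝓗.Δ₁ 𝓗.Δ₂ (fun q r => rs 𝓗.len 𝓗.Δ₁ 𝓗.Δ₂ (fun r1 r2 =>
        rs 𝓗.len 𝓗.Δ₁ 𝓗.Δ₂ (fun g1 g2 => φ (MA.act q a ⊗ₜ[k] (p * g2 * 𝓗.S r1))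
          (r2 * 𝓗.Sinv g1 * (𝓗.Sinv p1 * s))) g) r) z)]
    rw [hact_right 𝓗 MA hact,
      rs_push (k := k) _ _ _ (fun x => rs ℓ P Q (fun u v => φ u (v * s)) x)]
    refine rs_congr fun p z => ?_
    rw [rs_push (k := k) _ _ _ (fun x => rs ℓ P Q (fun u v => φ u (v * s)) x)]
    rw [rs_comm]
    refine rs_congr fun q r => ?_
    rw [rho_pure 𝓗 ℓ P Q hρ, sw_mul, sw_mul]
    refine rs_congr fun p1 p2 => ?_
    rw [rs_comm]
    simp only [sw_S]
    refine rs_congr fun r1 r2 => rs_congr fun g1 g2 => ?_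
    simp only [Sinv_mul, 𝓗.Sinv_S, mul_assoc]
  simp only [lhs]
  rw [← sw_coassoc 𝓗 (fun s p1 w => rs 𝓗.len 𝓗.Δ₁ 𝓗.Δ₂ (fun p z => rs 𝓗.len 𝓗.Δ₁ 𝓗.Δ₂ (fun q r => rs 𝓗.len 𝓗.Δ₁ 𝓗.Δ₂ (fun r1 r2 =>
        rs 𝓗.len 𝓗.Δ₁ 𝓗.Δ₂ (fun g1 g2 => φ (MA.act q a ⊗ₜ[k] (p * g2 * 𝓗.S r1))
          (r2 * 𝓗.Sinv g1 * (𝓗.Sinv p1 * s))) g) r) z) w)]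
  rw [← sw_counit_left 𝓗 (fun w => rs 𝓗.len 𝓗.Δ₁ 𝓗.Δ₂ (fun p z => rs 𝓗.len 𝓗.Δ₁ 𝓗.Δ₂ (fun q r => rs 𝓗.len 𝓗.Δ₁ 𝓗.Δ₂ (fun r1 r2 =>
        rs 𝓗.len 𝓗.Δ₁ 𝓗.Δ₂ (fun g1 g2 => φ (MA.act q a ⊗ₜ[k] (p * g2 * 𝓗.S r1))
          (r2 * 𝓗.Sinv g1)) g) r) z) w)]
  refine rs_congr fun t w => ?_
  rw [sw_anti_inv 𝓗 (fun m => rs 𝓗.len 𝓗.Δ₁ 𝓗.Δ₂ (fun p z => rs 𝓗.len 𝓗.Δ₁ 𝓗.Δ₂ (fun q r => rs 𝓗.len 𝓗.Δ₁ 𝓗.Δ₂ (fun r1 r2 =>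
        rs 𝓗.len 𝓗.Δ₁ 𝓗.Δ₂ (fun g1 g2 => φ (MA.act q a ⊗ₜ[k] (p * g2 * 𝓗.S r1))
          (r2 * 𝓗.Sinv g1 * m)) g) r) z) w)]
  simp only [mul_one]

end main

end SwYD


open Finset in
open scoped TensorProduct in
/-- For an `H`-module algebra `A`, the algebra `A ⊗ H` with
componentwise multiplication, the action
`g ⬝ (a ⊗ h) = g⁽¹⁾ ⬝ a ⊗ g⁽⁰⁾ h S(g⁽²⁾)` and the coaction
`ρ(a ⊗ h) = (a ⊗ h⁽¹⁾) ⊗ S⁻¹(h⁽⁰⁾)` is a Yetter-Drinfeld `H`-module algebra.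
The coaction data is given pointwise, characterized on pure tensors in
separating form, together with separating additivity and homogeneity. -/
theorem tensor_with_hopf_yd {k H A : Type u} [Field k] [CharZero k]
    [Ring H] [Algebra k H] [Ring A] [Algebra k A]
    (𝓗 : SweedlerHopf k H) (MA : SweedlerMA 𝓗 A)
    (act2 : H →ₗ[k] (A ⊗[k] H) →ₗ[k] (A ⊗[k] H))
    (hact : ∀ (g : H) (a : A) (h : H),
      act2 g (a ⊗ₜ[k] h)
        = ∑ i ∈ range (𝓗.len g), ∑ l ∈ range (𝓗.len (𝓗.Δ₁ g i)),
            (MA.act (𝓗.Δ₂ (𝓗.Δ₁ g i) l) a)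
              ⊗ₜ[k] (𝓗.Δ₁ (𝓗.Δ₁ g i) l * h * 𝓗.S (𝓗.Δ₂ g i)))
    (ρ2len : A ⊗[k] H → ℕ) (ρ2A : A ⊗[k] H → ℕ → A ⊗[k] H)
    (ρ2H : A ⊗[k] H → ℕ → H)
    (hρ_pure : ∀ (M : Type u) [AddCommGroup M] [Module k M]
      (φ : (A ⊗[k] H) →ₗ[k] H →ₗ[k] M) (a : A) (h : H),
      (∑ j ∈ range (ρ2len (a ⊗ₜ[k] h)), φ (ρ2A (a ⊗ₜ[k] h) j) (ρ2H (a ⊗ₜ[k] h) j))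
        = ∑ i ∈ range (𝓗.len h), φ (a ⊗ₜ[k] 𝓗.Δ₂ h i) (𝓗.Sinv (𝓗.Δ₁ h i)))
    (hρ_add : ∀ (M : Type u) [AddCommGroup M] [Module k M]
      (φ : (A ⊗[k] H) →ₗ[k] H →ₗ[k] M) (x y : A ⊗[k] H),
      (∑ j ∈ range (ρ2len (x + y)), φ (ρ2A (x + y) j) (ρ2H (x + y) j))
        = (∑ j ∈ range (ρ2len x), φ (ρ2A x j) (ρ2H x j))
          + ∑ j ∈ range (ρ2len y), φ (ρ2A y j) (ρ2H y j))
    (hρ_smul : ∀ (M : Type u) [AddCommGroup M] [Module k M]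
      (φ : (A ⊗[k] H) →ₗ[k] H →ₗ[k] M) (c : k) (x : A ⊗[k] H),
      (∑ j ∈ range (ρ2len (c • x)), φ (ρ2A (c • x) j) (ρ2H (c • x) j))
        = c • ∑ j ∈ range (ρ2len x), φ (ρ2A x j) (ρ2H x j)) :
    ∃ Y : SweedlerYD 𝓗 (A ⊗[k] H),
      Y.act = act2 ∧ Y.ρlen = ρ2len ∧ Y.ρA = ρ2A ∧ Y.ρH = ρ2H := by
  classical
  rcases subsingleton_or_nontrivial A with hA | hA
  · haveI : Subsingleton (A ⊗[k] H) := by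
      refine ⟨fun x y => ?_⟩
      have h0 : ∀ z : A ⊗[k] H, z = 0 := by
        intro z
        induction z using TensorProduct.induction_on with
        | zero => rfl
        | tmul a h => rw [Subsingleton.elim a 0, TensorProduct.zero_tmul]
        | add x y hx hy => rw [hx, hy, add_zero]
      rw [h0 x, h0 y]
    have hz : ∀ x : A ⊗[k] H, x = 0 := fun x => Subsingleton.elim _ _
    exact ⟨{ act := act2
             act_mul := fun _ _ _ => Subsingleton.elim _ _
             act_one := fun _ => Subsingleton.elim _ _
             act_mul_distrib := fun _ _ _ => Subsingleton.elim _ _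
             act_unit := fun _ => Subsingleton.elim _ _
             ρlen := ρ2len
             ρA := ρ2A
             ρH := ρ2H
             ρ_counit := fun _ => Subsingleton.elim _ _
             ρ_coassoc := by
               intro M _ _ φ a
               have hφ : φ = 0 := LinearMap.ext fun x => by rw [hz x]; simp
               simp [hφ]
             ρ_mul := by
               intro M _ _ φ a b
               have hφ : φ = 0 := LinearMap.ext fun x => by rw [hz x]; simp
               simp [hφ]
             ρ_one := by
               intro M _ _ φ
               have hφ : φ = 0 := LinearMap.ext fun x => by rw [hz x]; simp
               simp [hφ]
             yd := by
               intro M _ _ φ h a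
               have hφ : φ = 0 := LinearMap.ext fun x => by rw [hz x]; simp
               simp [hφ] }, rfl, rfl, rfl, rfl⟩
  · obtain ⟨f, hf⟩ : ∃ f : A →ₗ[k] k, f 1 = 1 := by
      obtain ⟨f, hf⟩ := Module.Projective.exists_dual_ne_zero k (one_ne_zero : (1 : A) ≠ 0)
      exact ⟨(f 1)⁻¹ • f, by simp [hf]⟩
    haveI i1 : SwYD.LinR k ρ2len ρ2A ρ2H :=
      ⟨fun M _ _ φ => ⟨fun x y => hρ_add M φ x y, fun c x => hρ_smul M φ c x⟩⟩
    have hρ : SwYD.HRho 𝓗 ρ2len ρ2A ρ2H := fun M _ _ φ a h => hρ_pure M φ a h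
    haveI i2 : SwYD.LinR k 𝓗.len 𝓗.Δ₁ 𝓗.Δ₂ := by
      refine ⟨fun M _ _ φ => ?_⟩
      have e : ∀ h, SwYD.rs 𝓗.len 𝓗.Δ₁ 𝓗.Δ₂ (fun a b => φ a b) h
          = SwYD.rs ρ2len ρ2A ρ2H (fun u v => φ (𝓗.S v)
              (TensorProduct.lid k H (TensorProduct.map f LinearMap.id u))) ((1 : A) ⊗ₜ[k] h) := by
        intro h
        have := hρ M (SwYD.bi k (fun u v => φ (𝓗.S v)
              ((TensorProduct.lid k H).toLinearMap (TensorProduct.map f LinearMap.id u)))) 1 h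
        simp only [SwYD.bi_apply] at this
        refine Eq.trans ?_ this.symm
        refine SwYD.rs_congr fun a b => ?_
        simp [hf, 𝓗.S_Sinv]
      have l : SwYD.Lin k (fun h : H => SwYD.rs ρ2len ρ2A ρ2H (fun u v => φ (𝓗.S v)
              ((TensorProduct.lid k H).toLinearMap (TensorProduct.map f LinearMap.id u)))
              ((1 : A) ⊗ₜ[k] h)) := inferInstance
      rw [funext e]
      exact l
    have ha : SwYD.HAct 𝓗 MA act2 := hact
    exact ⟨{ act := act2
             act_mul := SwYD.a_mul 𝓗 MA ha
             act_one := SwYD.a_one 𝓗 MA ha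
             act_mul_distrib := SwYD.a_distrib 𝓗 MA ha
             act_unit := SwYD.a_unit 𝓗 MA ha
             ρlen := ρ2len
             ρA := ρ2A
             ρH := ρ2H
             ρ_counit := SwYD.r_counit 𝓗 ρ2len ρ2A ρ2H hρ
             ρ_coassoc := fun M _ _ φ a => SwYD.r_coassoc 𝓗 ρ2len ρ2A ρ2H hρ φ a
             ρ_mul := fun M _ _ φ a b => SwYD.r_mul 𝓗 ρ2len ρ2A ρ2H hρ φ a b
             ρ_one := fun M _ _ φ => SwYD.r_one 𝓗 ρ2len ρ2A ρ2H hρ φ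
             yd := fun M _ _ φ h a => SwYD.r_yd 𝓗 MA ρ2len ρ2A ρ2H ha hρ φ h a },
      rfl, rfl, rfl, rfl⟩
end

section
/- Let (H, R) be a quasitriangular Hopf algebra, A an H-module algebra and V a left H-module. The map t: A ⊗̄ End(V) → A ⊗ End(V), t(a ⊗ u) = R⁽²⁾·a ⊗ R⁽¹⁾u, is an isomorphism of H-module algebras with inverse t'(a ⊗ u) = R⁽²⁾·a ⊗ S(R⁽¹⁾)u. Here A ⊗̄ End(V) carries the componentwise product with action h·(a⊗u) = h⁽¹⁾·a ⊗ h⁽⁰⁾ u S(h⁽²⁾), and A ⊗ End(V) carries the twisted product (a⊗u)(c⊗v) = a c₍₀₎ ⊗ (c₍₁₎·u)v with diagonal action, where the A-coaction is ρ(a) = R⁽²⁾·a ⊗ R⁽¹⁾. -/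
universe u

/-- Build a trilinear map from a function of three variables. -/
def mkTri {k H M : Type u} [Field k] [Ring H] [Algebra k H] [AddCommGroup M] [Module k M]
    (f : H → H → H → M)
    (a1 : ∀ x x' y z, f (x + x') y z = f x y z + f x' y z)
    (s1 : ∀ (c : k) x y z, f (c • x) y z = c • f x y z)
    (a2 : ∀ x y y' z, f x (y + y') z = f x y z + f x y' z)
    (s2 : ∀ (c : k) x y z, f x (c • y) z = c • f x y z)
    (a3 : ∀ x y z z', f x y (z + z') = f x y z + f x y z')
    (s3 : ∀ (c : k) x y z, f x y (c • z) = c • f x y z) :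
    H →ₗ[k] H →ₗ[k] H →ₗ[k] M :=
  LinearMap.mk₂ k (fun x y => { toFun := f x y, map_add' := a3 x y, map_smul' := fun c => s3 c x y })
    (fun x x' y => LinearMap.ext fun z => a1 x x' y z)
    (fun c x y => LinearMap.ext fun z => s1 c x y z)
    (fun x y y' => LinearMap.ext fun z => a2 x y y' z)
    (fun c x y => LinearMap.ext fun z => s2 c x y z)

theorem mkTri_apply {k H M : Type u} [Field k] [Ring H] [Algebra k H] [AddCommGroup M]
    [Module k M] (f : H → H → H → M) (a1 s1 a2 s2 a3 s3) (x y z : H) :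
    mkTri (k := k) f a1 s1 a2 s2 a3 s3 x y z = f x y z := rfl

open Finset in
open scoped TensorProduct in
/-- Let `(H, R)` be quasitriangular, `A` an `H`-module
algebra and `V` a left `H`-module (via `r : H →ₐ End(V)`). The map
`t(a ⊗ u) = R⁽²⁾ ⬝ a ⊗ R⁽¹⁾ u` is an isomorphism of `H`-module algebras from
`A ⊗̄ End(V)` (componentwise product, action `h ⬝ (a⊗u) = h⁽¹⁾ ⬝ a ⊗ h⁽⁰⁾ u S(h⁽²⁾)`)
to `A ⊗ End(V)` (twisted product `(a⊗u)(c⊗v) = a c₍₀₎ ⊗ (c₍₁₎ ⬝ u) v` with the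
diagonal action, the coaction being `ρ(a) = R⁽²⁾ ⬝ a ⊗ R⁽¹⁾`), with inverse
`t'(a ⊗ u) = R⁽²⁾ ⬝ a ⊗ S(R⁽¹⁾) u`. -/
theorem quasitriangular_twist_iso {k H A V : Type u} [Field k] [CharZero k]
    [Ring H] [Algebra k H] [Ring A] [Algebra k A]
    [AddCommGroup V] [Module k V] [FiniteDimensional k V]
    (𝓗 : SweedlerHopf k H) (MA : SweedlerMA 𝓗 A)
    (r : H →ₐ[k] Module.End k V)
    (Rlen : ℕ) (R₁ R₂ : ℕ → H)
    (hRinv : ∃ (Rlen' : ℕ) (R₁' R₂' : ℕ → H),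
      (∀ (M : Type u) [AddCommGroup M] [Module k M] (φ : H →ₗ[k] H →ₗ[k] M),
        (∑ i ∈ range Rlen, ∑ j ∈ range Rlen',
          φ (R₁ i * R₁' j) (R₂ i * R₂' j)) = φ 1 1) ∧
      (∀ (M : Type u) [AddCommGroup M] [Module k M] (φ : H →ₗ[k] H →ₗ[k] M),
        (∑ j ∈ range Rlen', ∑ i ∈ range Rlen,
          φ (R₁' j * R₁ i) (R₂' j * R₂ i)) = φ 1 1))
    (hR1 : ∀ (M : Type u) [AddCommGroup M] [Module k M]
      (φ : H →ₗ[k] H →ₗ[k] H →ₗ[k] M),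
      (∑ i ∈ range Rlen, ∑ l ∈ range (𝓗.len (R₁ i)),
        φ (𝓗.Δ₁ (R₁ i) l) (𝓗.Δ₂ (R₁ i) l) (R₂ i))
      = ∑ i ∈ range Rlen, ∑ j ∈ range Rlen, φ (R₁ i) (R₁ j) (R₂ i * R₂ j))
    (hR2 : ∀ (M : Type u) [AddCommGroup M] [Module k M]
      (φ : H →ₗ[k] H →ₗ[k] H →ₗ[k] M),
      (∑ i ∈ range Rlen, ∑ l ∈ range (𝓗.len (R₂ i)),
        φ (R₁ i) (𝓗.Δ₁ (R₂ i) l) (𝓗.Δ₂ (R₂ i) l))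
      = ∑ i ∈ range Rlen, ∑ j ∈ range Rlen, φ (R₁ i * R₁ j) (R₂ j) (R₂ i))
    (hRΔ : ∀ (M : Type u) [AddCommGroup M] [Module k M]
      (φ : H →ₗ[k] H →ₗ[k] M) (h : H),
      (∑ l ∈ range (𝓗.len h), ∑ i ∈ range Rlen,
        φ (𝓗.Δ₂ h l * R₁ i) (𝓗.Δ₁ h l * R₂ i))
      = ∑ i ∈ range Rlen, ∑ l ∈ range (𝓗.len h),
          φ (R₁ i * 𝓗.Δ₁ h l) (R₂ i * 𝓗.Δ₂ h l))
    (hRε1 : (∑ i ∈ range Rlen, 𝓗.ε (R₁ i) • R₂ i) = 1)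
    (hRε2 : (∑ i ∈ range Rlen, 𝓗.ε (R₂ i) • R₁ i) = 1)
    -- `(S ⊗ id) R = R⁻¹`
    (hSR : (∀ (M : Type u) [AddCommGroup M] [Module k M] (φ : H →ₗ[k] H →ₗ[k] M),
        (∑ i ∈ range Rlen, ∑ j ∈ range Rlen,
          φ (𝓗.S (R₁ i) * R₁ j) (R₂ i * R₂ j)) = φ 1 1) ∧
      (∀ (M : Type u) [AddCommGroup M] [Module k M] (φ : H →ₗ[k] H →ₗ[k] M),
        (∑ j ∈ range Rlen, ∑ i ∈ range Rlen,
          φ (R₁ j * 𝓗.S (R₁ i)) (R₂ j * R₂ i)) = φ 1 1))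
    -- the twisted multiplication on `A ⊗ End(V)`
    (m : (A ⊗[k] Module.End k V) →ₗ[k] (A ⊗[k] Module.End k V) →ₗ[k]
          (A ⊗[k] Module.End k V))
    (hm : ∀ (a c : A) (u v : Module.End k V),
      m (a ⊗ₜ[k] u) (c ⊗ₜ[k] v)
        = ∑ i ∈ range Rlen, ∑ l ∈ range (𝓗.len (R₁ i)),
            (a * MA.act (R₂ i) c)
              ⊗ₜ[k] (r (𝓗.Δ₁ (R₁ i) l) * u * r (𝓗.S (𝓗.Δ₂ (R₁ i) l)) * v))
    -- the non-diagonal action on `A ⊗̄ End(V)`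
    (actbar : H →ₗ[k] (A ⊗[k] Module.End k V) →ₗ[k] (A ⊗[k] Module.End k V))
    (hactbar : ∀ (h : H) (a : A) (u : Module.End k V),
      actbar h (a ⊗ₜ[k] u)
        = ∑ i ∈ range (𝓗.len h), ∑ l ∈ range (𝓗.len (𝓗.Δ₁ h i)),
            (MA.act (𝓗.Δ₂ (𝓗.Δ₁ h i) l) a)
              ⊗ₜ[k] (r (𝓗.Δ₁ (𝓗.Δ₁ h i) l) * u * r (𝓗.S (𝓗.Δ₂ h i))))
    -- the diagonal action on `A ⊗ End(V)` (conjugation on `End(V)`)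
    (act2 : H →ₗ[k] (A ⊗[k] Module.End k V) →ₗ[k] (A ⊗[k] Module.End k V))
    (hact2 : ∀ (h : H) (a : A) (u : Module.End k V),
      act2 h (a ⊗ₜ[k] u)
        = ∑ i ∈ range (𝓗.len h), ∑ l ∈ range (𝓗.len (𝓗.Δ₂ h i)),
            (MA.act (𝓗.Δ₁ h i) a)
              ⊗ₜ[k] (r (𝓗.Δ₁ (𝓗.Δ₂ h i) l) * u * r (𝓗.S (𝓗.Δ₂ (𝓗.Δ₂ h i) l)))) :
    -- `t` and `t'` are mutually inverse, `t` is multiplicative, unital and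
    -- `H`-equivariant
    (∀ x : A ⊗[k] Module.End k V,
      (∑ i ∈ range Rlen,
        TensorProduct.map (MA.act (R₂ i)) (LinearMap.mulLeft k (r (𝓗.S (R₁ i)))))
      ((∑ i ∈ range Rlen,
        TensorProduct.map (MA.act (R₂ i)) (LinearMap.mulLeft k (r (R₁ i)))) x) = x) ∧
    (∀ x : A ⊗[k] Module.End k V,
      (∑ i ∈ range Rlen,
        TensorProduct.map (MA.act (R₂ i)) (LinearMap.mulLeft k (r (R₁ i))))
      ((∑ i ∈ range Rlen,
        TensorProduct.map (MA.act (R₂ i)) (LinearMap.mulLeft k (r (𝓗.S (R₁ i))))) x) = x) ∧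
    (∀ x y : A ⊗[k] Module.End k V,
      (∑ i ∈ range Rlen,
        TensorProduct.map (MA.act (R₂ i)) (LinearMap.mulLeft k (r (R₁ i)))) (x * y)
      = m ((∑ i ∈ range Rlen,
          TensorProduct.map (MA.act (R₂ i)) (LinearMap.mulLeft k (r (R₁ i)))) x)
          ((∑ i ∈ range Rlen,
          TensorProduct.map (MA.act (R₂ i)) (LinearMap.mulLeft k (r (R₁ i)))) y)) ∧
    ((∑ i ∈ range Rlen,
        TensorProduct.map (MA.act (R₂ i)) (LinearMap.mulLeft k (r (R₁ i))))
      (1 : A ⊗[k] Module.End k V) = 1) ∧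
    (∀ (h : H) (x : A ⊗[k] Module.End k V),
      (∑ i ∈ range Rlen,
        TensorProduct.map (MA.act (R₂ i)) (LinearMap.mulLeft k (r (R₁ i))))
        (actbar h x)
      = act2 h ((∑ i ∈ range Rlen,
          TensorProduct.map (MA.act (R₂ i)) (LinearMap.mulLeft k (r (R₁ i)))) x)) := by
  classical
  -- bilinear family `(x, y) ↦ L (y ⬝ a) ⊗ p x w`
  let B : (A →ₗ[k] A) → A → Module.End k V → Module.End k V →
      (H →ₗ[k] H →ₗ[k] (A ⊗[k] Module.End k V)) := fun L a p w =>
    LinearMap.mk₂ k (fun x y => L (MA.act y a) ⊗ₜ[k] (p * r x * w))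
      (by intros; simp [mul_add, add_mul, TensorProduct.tmul_add])
      (by intros; simp [TensorProduct.tmul_smul])
      (by intros; simp [TensorProduct.add_tmul])
      (by intros; simp [TensorProduct.smul_tmul'])
  have hB : ∀ L a p w x y, B L a p w x y = L (MA.act y a) ⊗ₜ[k] (p * r x * w) :=
    fun _ _ _ _ _ _ => rfl
  refine ⟨?_, ?_, ?_, ?_, ?_⟩
  · intro x
    induction x with
    | zero => simp
    | add x y hx hy => rw [map_add, map_add, hx, hy]
    | tmul a u =>
      have h := hSR.1 _ (B LinearMap.id a 1 u)
      simp only [hB, LinearMap.id_apply, map_one, one_mul, map_mul, MA.act_mul, MA.act_one] at h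
      simp only [LinearMap.sum_apply, TensorProduct.map_tmul, map_sum, LinearMap.mulLeft_apply,
        ← mul_assoc]
      rw [← h]
      try rw [Finset.sum_comm]
  · intro x
    induction x with
    | zero => simp
    | add x y hx hy => rw [map_add, map_add, hx, hy]
    | tmul a u =>
      have h := hSR.2 _ (B LinearMap.id a 1 u)
      simp only [hB, LinearMap.id_apply, map_one, one_mul, map_mul, MA.act_mul, MA.act_one] at h
      simp only [LinearMap.sum_apply, TensorProduct.map_tmul, map_sum, LinearMap.mulLeft_apply,
        ← mul_assoc]
      rw [← h]
      try rw [Finset.sum_comm]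
  · intro x y
    induction x with
    | zero => simp
    | add x x' hx hx' => rw [add_mul, map_add, map_add, map_add, hx, hx', LinearMap.add_apply]
    | tmul a u =>
    induction y with
    | zero => simp
    | add x y hx hy => rw [mul_add, map_add, map_add, map_add, hx, hy]
    | tmul c v =>
      -- left-hand side
      have h2 : (∑ i ∈ range Rlen, ∑ l ∈ range (𝓗.len (R₂ i)),
          (MA.act (𝓗.Δ₁ (R₂ i) l) a * MA.act (𝓗.Δ₂ (R₂ i) l) c) ⊗ₜ[k] (r (R₁ i) * (u * v)))
          = ∑ i ∈ range Rlen, ∑ j ∈ range Rlen,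
            (MA.act (R₂ j) a * MA.act (R₂ i) c) ⊗ₜ[k] (r (R₁ i * R₁ j) * (u * v)) := hR2 _ (mkTri (k := k) (fun x y z => (MA.act y a * MA.act z c) ⊗ₜ[k] (r x * (u * v)))
        (by intros; simp [add_mul, TensorProduct.tmul_add])
        (by intros; simp [TensorProduct.tmul_smul])
        (by intros; simp [add_mul, TensorProduct.add_tmul])
        (by intros; simp [TensorProduct.smul_tmul'])
        (by intros; simp [mul_add, TensorProduct.add_tmul])
        (by intros; simp [TensorProduct.smul_tmul']))
      have hL : (∑ i ∈ range Rlen,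
          TensorProduct.map (MA.act (R₂ i)) (LinearMap.mulLeft k (r (R₁ i))))
            ((a ⊗ₜ[k] u) * (c ⊗ₜ[k] v)) = ∑ i ∈ range Rlen, ∑ j ∈ range Rlen,
            (MA.act (R₂ j) a * MA.act (R₂ i) c) ⊗ₜ[k] (r (R₁ i * R₁ j) * (u * v)) := by
        rw [← h2]
        simp only [LinearMap.sum_apply, Algebra.TensorProduct.tmul_mul_tmul,
          TensorProduct.map_tmul, LinearMap.mulLeft_apply, MA.act_mul_distrib,
          TensorProduct.sum_tmul]
      rw [hL]
      simp only [LinearMap.sum_apply, TensorProduct.map_tmul, map_sum, LinearMap.mulLeft_apply]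
      -- right-hand side, for fixed `p`, `q`
      have key : ∀ p q, m (MA.act (R₂ p) a ⊗ₜ[k] (r (R₁ p) * u))
          (MA.act (R₂ q) c ⊗ₜ[k] (r (R₁ q) * v)) =
          ∑ i ∈ range Rlen, ∑ j ∈ range Rlen,
            (MA.act (R₂ p) a * MA.act (R₂ i) (MA.act (R₂ j * R₂ q) c)) ⊗ₜ[k]
              (r (R₁ i) * (r (R₁ p) * u) * r (𝓗.S (R₁ j) * R₁ q) * v) := by
        intro p q
        have h1 : (∑ i ∈ range Rlen, ∑ l ∈ range (𝓗.len (R₁ i)),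
            (MA.act (R₂ p) a * MA.act (R₂ i) (MA.act (R₂ q) c)) ⊗ₜ[k]
            (r (𝓗.Δ₁ (R₁ i) l) * (r (R₁ p) * u) * r (𝓗.S (𝓗.Δ₂ (R₁ i) l)) * (r (R₁ q) * v)))
            = ∑ i ∈ range Rlen, ∑ j ∈ range Rlen,
            (MA.act (R₂ p) a * MA.act (R₂ i * R₂ j) (MA.act (R₂ q) c)) ⊗ₜ[k]
            (r (R₁ i) * (r (R₁ p) * u) * r (𝓗.S (R₁ j)) * (r (R₁ q) * v)) := hR1 _ (mkTri (k := k) (fun x y z =>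
          (MA.act (R₂ p) a * MA.act z (MA.act (R₂ q) c)) ⊗ₜ[k]
            (r x * (r (R₁ p) * u) * r (𝓗.S y) * (r (R₁ q) * v)))
          (by intros; simp [add_mul, TensorProduct.tmul_add])
          (by intros; simp [TensorProduct.tmul_smul])
          (by intros; simp [add_mul, mul_add, TensorProduct.tmul_add])
          (by intros; simp [TensorProduct.tmul_smul])
          (by intros; simp [mul_add, TensorProduct.add_tmul])
          (by intros; simp [TensorProduct.smul_tmul']))
        rw [hm, h1]
        simp only [MA.act_mul, map_mul, mul_assoc]
      have key2 : ∀ p i, ∑ j ∈ range Rlen, ∑ q ∈ range Rlen,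
            (MA.act (R₂ p) a * MA.act (R₂ i) (MA.act (R₂ j * R₂ q) c)) ⊗ₜ[k]
              (r (R₁ i) * (r (R₁ p) * u) * r (𝓗.S (R₁ j) * R₁ q) * v) =
          (MA.act (R₂ p) a * MA.act (R₂ i) c) ⊗ₜ[k] (r (R₁ i * R₁ p) * (u * v)) := by
        intro p i
        have h := hSR.1 _ (B (LinearMap.mulLeft k (MA.act (R₂ p) a) ∘ₗ MA.act (R₂ i)) c
          (r (R₁ i) * (r (R₁ p) * u)) v)
        simp only [hB, LinearMap.comp_apply, LinearMap.mulLeft_apply] at h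
        rw [h]
        simp only [map_one, MA.act_one, mul_one, map_mul, mul_assoc]
      simp only [key, LinearMap.sum_apply]
      simp only [← key2]
      -- `∑ i p j q = ∑ q p i j`
      have swap : ∀ F : ℕ → ℕ → ℕ → ℕ → (A ⊗[k] Module.End k V),
          (∑ i ∈ range Rlen, ∑ p ∈ range Rlen, ∑ j ∈ range Rlen, ∑ q ∈ range Rlen, F i p j q) =
          ∑ q ∈ range Rlen, ∑ p ∈ range Rlen, ∑ i ∈ range Rlen, ∑ j ∈ range Rlen, F i p j q := by
        intro F
        rw [Finset.sum_comm]
        conv_rhs => rw [Finset.sum_comm]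
        refine Finset.sum_congr rfl fun p _ => ?_
        conv_rhs => rw [Finset.sum_comm]
        refine Finset.sum_congr rfl fun i _ => ?_
        rw [Finset.sum_comm]
      exact swap fun i p j q => (MA.act (R₂ p) a * MA.act (R₂ i) (MA.act (R₂ j * R₂ q) c)) ⊗ₜ[k]
              (r (R₁ i) * (r (R₁ p) * u) * r (𝓗.S (R₁ j) * R₁ q) * v)
  · have h : (∑ i ∈ range Rlen, 𝓗.ε (R₂ i) • r (R₁ i)) = 1 := by
      rw [← map_one r, ← hRε2]; simp
    rw [Algebra.TensorProduct.one_def]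
    simp only [LinearMap.sum_apply, TensorProduct.map_tmul, LinearMap.mulLeft_apply, MA.act_unit,
      mul_one, TensorProduct.smul_tmul]
    rw [← TensorProduct.tmul_sum, h]
  · intro h x
    induction x with
    | zero => simp
    | add x y hx hy => simp only [map_add, hx, hy]
    | tmul a u =>
      have key : ∀ i, (∑ l ∈ range (𝓗.len (𝓗.Δ₁ h i)), ∑ j ∈ range Rlen,
          (MA.act (𝓗.Δ₁ (𝓗.Δ₁ h i) l * R₂ j) a) ⊗ₜ[k]
            (1 * r (𝓗.Δ₂ (𝓗.Δ₁ h i) l * R₁ j) * (u * r (𝓗.S (𝓗.Δ₂ h i))))) =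
          ∑ j ∈ range Rlen, ∑ l ∈ range (𝓗.len (𝓗.Δ₁ h i)),
          (MA.act (R₂ j * 𝓗.Δ₂ (𝓗.Δ₁ h i) l) a) ⊗ₜ[k]
            (1 * r (R₁ j * 𝓗.Δ₁ (𝓗.Δ₁ h i) l) * (u * r (𝓗.S (𝓗.Δ₂ h i)))) := fun i =>
        hRΔ _ (B LinearMap.id a 1 (u * r (𝓗.S (𝓗.Δ₂ h i)))) (𝓗.Δ₁ h i)
      have hL : (∑ i ∈ range Rlen,
          TensorProduct.map (MA.act (R₂ i)) (LinearMap.mulLeft k (r (R₁ i))))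
            (actbar h (a ⊗ₜ[k] u)) = ∑ i ∈ range (𝓗.len h),
          ∑ l ∈ range (𝓗.len (𝓗.Δ₁ h i)), ∑ j ∈ range Rlen,
          (MA.act (𝓗.Δ₁ (𝓗.Δ₁ h i) l * R₂ j) a) ⊗ₜ[k]
            (1 * r (𝓗.Δ₂ (𝓗.Δ₁ h i) l * R₁ j) * (u * r (𝓗.S (𝓗.Δ₂ h i)))) := by
        simp only [key]
        rw [hactbar, Finset.sum_comm]
        simp only [LinearMap.sum_apply, map_sum, TensorProduct.map_tmul,
          LinearMap.mulLeft_apply, MA.act_mul, map_mul, one_mul, mul_assoc]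
        try rw [Finset.sum_comm]
        try (refine Finset.sum_congr rfl fun i _ => ?_
             rw [Finset.sum_comm])
      rw [hL]
      have hc : ∀ j, (∑ i ∈ range (𝓗.len h), ∑ l ∈ range (𝓗.len (𝓗.Δ₁ h i)),
          (MA.act (𝓗.Δ₁ (𝓗.Δ₁ h i) l) (MA.act (R₂ j) a)) ⊗ₜ[k]
            (r (𝓗.Δ₂ (𝓗.Δ₁ h i) l) * (r (R₁ j) * u) * r (𝓗.S (𝓗.Δ₂ h i))))
          = ∑ i ∈ range (𝓗.len h), ∑ l ∈ range (𝓗.len (𝓗.Δ₂ h i)),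
          (MA.act (𝓗.Δ₁ h i) (MA.act (R₂ j) a)) ⊗ₜ[k]
            (r (𝓗.Δ₁ (𝓗.Δ₂ h i) l) * (r (R₁ j) * u) * r (𝓗.S (𝓗.Δ₂ (𝓗.Δ₂ h i) l))) :=
        fun j => 𝓗.coassoc _ (mkTri (k := k) (fun x y z =>
          (MA.act x (MA.act (R₂ j) a)) ⊗ₜ[k] (r y * (r (R₁ j) * u) * r (𝓗.S z)))
          (by intros; simp [TensorProduct.add_tmul])
          (by intros; simp [TensorProduct.smul_tmul'])
          (by intros; simp [add_mul, TensorProduct.tmul_add])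
          (by intros; simp [TensorProduct.tmul_smul])
          (by intros; simp [mul_add, TensorProduct.tmul_add])
          (by intros; simp [TensorProduct.tmul_smul])) h
      simp only [LinearMap.sum_apply, map_sum, TensorProduct.map_tmul, LinearMap.mulLeft_apply,
        hact2]
      simp only [← hc]
      rw [Finset.sum_comm]
      refine Finset.sum_congr rfl fun i _ => ?_
      rw [Finset.sum_comm]
      simp only [MA.act_mul, map_mul, one_mul, mul_assoc]
end
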